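/- Let S be a numerical semigroup with m(S) ≤ 6. Then S satisfies Wilf's conjecture, i.e. f(S) + 1 ≤ n(S)·ν(S). -/

import Mathlib

/-- A numerical semigroup: an additive submonoid of `ℕ` (containing `0`, closed under
addition) whose complement in `ℕ` is finite. -/
structure NumericalSemigroup where
  carrier : Set ℕ
  zero_mem : 0 ∈ carrier
  add_mem : ∀ ⦃a b : ℕ⦄, a ∈ carrier → b ∈ carrier → a + b ∈ carrier
  cofinite : (carrierᶜ : Set ℕ).Finite

namespace NumericalSemigroup

/-- The multiplicity `m(S)`: the smallest positive element of `S`. -/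
noncomputable def mult (S : NumericalSemigroup) : ℕ :=
  sInf {s : ℕ | s ∈ S.carrier ∧ 0 < s}

/-- The embedding dimension `ν(S)`: the cardinality of the (unique) minimal system of
generators of `S`, i.e. the least cardinality of a generating set. -/
noncomputable def embdim (S : NumericalSemigroup) : ℕ :=
  sInf {n : ℕ | ∃ G : Finset ℕ,
    S.carrier = (AddSubmonoid.closure (G : Set ℕ) : Set ℕ) ∧ G.card = n}

/-- The Frobenius number `f(S)`: the largest integer not belonging to `S`. -/
noncomputable def frob (S : NumericalSemigroup) : ℤ :=
  sSup {x : ℤ | ∀ s ∈ S.carrier, (s : ℤ) ≠ x}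

/-- `n(S)`: the number of elements of `S` smaller than the Frobenius number. -/
noncomputable def small (S : NumericalSemigroup) : ℕ :=
  {s : ℕ | s ∈ S.carrier ∧ (s : ℤ) < S.frob}.ncard

/-- The type `t(S)`: the number of pseudo-Frobenius numbers of `S`, i.e. integers
`x ∉ S` such that `x + s ∈ S` for every nonzero `s ∈ S`. -/
noncomputable def typ (S : NumericalSemigroup) : ℕ :=
  {x : ℤ | (∀ s ∈ S.carrier, (s : ℤ) ≠ x) ∧
    ∀ s ∈ S.carrier, 0 < s → ∃ u ∈ S.carrier, (u : ℤ) = x + s}.ncard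

/-- The `k`-th interval `I_k = [k·m, (k+1)·m - 1]` (for a given `m`). -/
def interval (m k : ℕ) : Set ℕ := Set.Ico (k * m) ((k + 1) * m)

/-- `n_k`: the number of elements of `S ∩ I_k` smaller than the Frobenius number. -/
noncomputable def nk (S : NumericalSemigroup) (k : ℕ) : ℕ :=
  {s : ℕ | s ∈ S.carrier ∩ interval S.mult k ∧ (s : ℤ) < S.frob}.ncard

/-- `L = ⌊f(S)/m(S)⌋`. -/
noncomputable def Lindex (S : NumericalSemigroup) : ℤ := S.frob / (S.mult : ℤ)

/-- `ρ = f(S) + 1 - L·m(S)`. -/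
noncomputable def rho (S : NumericalSemigroup) : ℤ :=
  S.frob + 1 - S.Lindex * (S.mult : ℤ)

/-- The Apéry set `Ap(S) = {w ∈ S : w - m(S) ∉ S}`. -/
def apery (S : NumericalSemigroup) : Set ℕ :=
  {w : ℕ | w ∈ S.carrier ∧ ∀ u ∈ S.carrier, u + S.mult ≠ w}

theorem apery_finite (S : NumericalSemigroup) : S.apery.Finite := by
  apply Set.Finite.subset ((Set.finite_Iio S.mult).union (S.cofinite.image (· + S.mult)))
  intro x hx
  by_cases h : x < S.mult
  · exact Or.inl h
  · refine Or.inr ⟨x - S.mult, fun hmem => hx.2 _ hmem (by omega), ?_⟩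
    show x - S.mult + S.mult = x
    omega

/-- `w j`: the `(j+1)`-st smallest element of the Apéry set, so that
`Ap(S) = {w 0 < w 1 < ... < w (m-1)}` with `w 0 = 0`. -/
noncomputable def w (S : NumericalSemigroup) (j : ℕ) : ℕ :=
  (S.apery_finite.toFinset.sort (· ≤ ·)).getD j 0

/-- `ε_j`: the number of `k ∈ {0, ..., L-1}` such that `|I_k ∩ S| = j`. -/
noncomputable def eps (S : NumericalSemigroup) (j : ℕ) : ℕ :=
  {k : ℕ | (k : ℤ) < S.Lindex ∧ (S.carrier ∩ interval S.mult k).ncard = j}.ncard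

/-- `η_j`: the number of `k ∈ ℕ` such that `|I_k ∩ S| = j`. -/
noncomputable def eta (S : NumericalSemigroup) (j : ℕ) : ℕ :=
  {k : ℕ | (S.carrier ∩ interval S.mult k).ncard = j}.ncard

set_option linter.unusedVariables false
set_option linter.unnecessarySeqFocus false

theorem exists_pos (S : NumericalSemigroup) : ∃ s, s ∈ S.carrier ∧ 0 < s := by
  by_contra hcon
  push Not at hcon
  refine Set.Ioi_infinite 0 (S.cofinite.subset ?_)
  intro x hx hxs
  have := hcon x hxs
  simp at hx
  omega

theorem mult_spec (S : NumericalSemigroup) : S.mult ∈ S.carrier ∧ 0 < S.mult :=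
  Nat.sInf_mem (s := {s : ℕ | s ∈ S.carrier ∧ 0 < s}) S.exists_pos

theorem mult_le (S : NumericalSemigroup) {s : ℕ} (hs : s ∈ S.carrier) (h0 : 0 < s) :
    S.mult ≤ s :=
  Nat.sInf_le (s := {s : ℕ | s ∈ S.carrier ∧ 0 < s}) ⟨hs, h0⟩

/-- Kunz coordinates. -/
noncomputable def kunz (S : NumericalSemigroup) (i : ℕ) : ℕ :=
  sInf {q : ℕ | q * S.mult + i ∈ S.carrier}

theorem kunz_ne (S : NumericalSemigroup) (i : ℕ) :
    ∃ q : ℕ, q * S.mult + i ∈ S.carrier := by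
  by_contra hcon
  push Not at hcon
  have hm := S.mult_spec.2
  refine Set.infinite_of_injective_forall_mem (f := fun q : ℕ => q * S.mult + i) ?_ ?_ S.cofinite
  · intro a b hab
    have : a * S.mult = b * S.mult := by simpa using hab
    exact Nat.eq_of_mul_eq_mul_right hm this
  · intro q
    exact hcon q

theorem kunz_mem (S : NumericalSemigroup) (i : ℕ) :
    S.kunz i * S.mult + i ∈ S.carrier :=
  Nat.sInf_mem (s := {q : ℕ | q * S.mult + i ∈ S.carrier}) (S.kunz_ne i)

theorem mem_iff (S : NumericalSemigroup) (q i : ℕ) :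
    q * S.mult + i ∈ S.carrier ↔ S.kunz i ≤ q := by
  constructor
  · intro h
    exact Nat.sInf_le (s := {q : ℕ | q * S.mult + i ∈ S.carrier}) h
  · intro h
    induction q, h using Nat.le_induction with
    | base => exact S.kunz_mem i
    | succ q _ ih =>
      have := S.add_mem ih S.mult_spec.1
      have e : q * S.mult + i + S.mult = (q + 1) * S.mult + i := by ring
      rwa [e] at this

theorem kunz_zero (S : NumericalSemigroup) : S.kunz 0 = 0 := by
  have := (S.mem_iff 0 0).1 (by simpa using S.zero_mem)
  omega

theorem kunz_pos (S : NumericalSemigroup) {i : ℕ} (h0 : 0 < i) (hi : i < S.mult) :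
    1 ≤ S.kunz i := by
  by_contra hcon
  have := (S.mem_iff 0 i).2 (by omega)
  have := S.mult_le this (by omega)
  omega

theorem kunz_add (S : NumericalSemigroup) (i j : ℕ) :
    S.kunz (i + j) ≤ S.kunz i + S.kunz j := by
  rw [← S.mem_iff]
  have := S.add_mem (S.kunz_mem i) (S.kunz_mem j)
  have e : S.kunz i * S.mult + i + (S.kunz j * S.mult + j)
    = (S.kunz i + S.kunz j) * S.mult + (i + j) := by ring
  rwa [e] at this

theorem kunz_add' (S : NumericalSemigroup) (i j t : ℕ) (h : i + j = S.mult + t) :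
    S.kunz t ≤ S.kunz i + S.kunz j + 1 := by
  rw [← S.mem_iff]
  have := S.add_mem (S.kunz_mem i) (S.kunz_mem j)
  have e : S.kunz i * S.mult + i + (S.kunz j * S.mult + j)
    = (S.kunz i + S.kunz j + 1) * S.mult + t := by
    have : S.kunz i * S.mult + i + (S.kunz j * S.mult + j)
      = (S.kunz i + S.kunz j) * S.mult + (i + j) := by ring
    rw [this, h]; ring
  rwa [e] at this

/-- `x` is not a sum of two nonzero elements of `S`. -/
def Irr (S : NumericalSemigroup) (x : ℕ) : Prop :=
  x ∈ S.carrier ∧ x ≠ 0 ∧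
    ∀ a ∈ S.carrier, ∀ b ∈ S.carrier, a ≠ 0 → b ≠ 0 → a + b ≠ x

theorem irr_mem_gen (S : NumericalSemigroup) (G : Set ℕ)
    (hG : S.carrier = (AddSubmonoid.closure G : Set ℕ)) {x : ℕ} (hx : S.Irr x) : x ∈ G := by
  have key : ∀ y ∈ AddSubmonoid.closure G, S.Irr y → y ∈ G := by
    intro y hy
    induction hy using AddSubmonoid.closure_induction with
    | mem y hy => exact fun _ => hy
    | zero => exact fun h => absurd rfl h.2.1
    | add a b ha hb iha ihb =>
      intro h
      have ha' : a ∈ S.carrier := by rw [hG]; exact ha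
      have hb' : b ∈ S.carrier := by rw [hG]; exact hb
      by_cases h1 : a = 0
      · subst h1; simp only [zero_add] at h ⊢; exact ihb h
      by_cases h2 : b = 0
      · subst h2; simp only [add_zero] at h ⊢; exact iha h
      exact absurd rfl (h.2.2 a ha' b hb' h1 h2)
  refine key x ?_ hx
  have := hx.1
  rw [hG] at this
  exact this

theorem gens_exist (S : NumericalSemigroup) :
    ∃ G : Finset ℕ, S.carrier = (AddSubmonoid.closure (G : Set ℕ) : Set ℕ) := by
  classical
  refine ⟨insert S.mult ((Finset.range S.mult).image (fun i => S.kunz i * S.mult + i)), ?_⟩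
  apply Set.Subset.antisymm
  · intro x hx
    have hm := S.mult_spec.2
    have hx' : x = x / S.mult * S.mult + x % S.mult := (Nat.div_add_mod' x S.mult).symm
    have hi : x % S.mult < S.mult := Nat.mod_lt _ hm
    rw [hx'] at hx
    have hle := (S.mem_iff _ _).1 hx
    obtain ⟨d, hd⟩ := Nat.exists_eq_add_of_le hle
    have e : x = d • S.mult + (S.kunz (x % S.mult) * S.mult + x % S.mult) := by
      rw [smul_eq_mul]
      calc x = x / S.mult * S.mult + x % S.mult := hx'
        _ = (S.kunz (x % S.mult) + d) * S.mult + x % S.mult := by rw [← hd]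
        _ = _ := by ring
    rw [e]
    refine AddSubmonoid.add_mem _ (AddSubmonoid.nsmul_mem _ (AddSubmonoid.subset_closure ?_) _)
      (AddSubmonoid.subset_closure ?_)
    · simp
    · simp only [Finset.coe_insert, Finset.coe_image]
      exact Or.inr ⟨x % S.mult, by simpa using hi, rfl⟩
  · let T : AddSubmonoid ℕ :=
      { carrier := S.carrier, zero_mem' := S.zero_mem, add_mem' := fun ha hb => S.add_mem ha hb }
    have : AddSubmonoid.closure ((insert S.mult ((Finset.range S.mult).image
        (fun i => S.kunz i * S.mult + i)) : Finset ℕ) : Set ℕ) ≤ T := by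
      rw [AddSubmonoid.closure_le]
      intro x hx
      simp only [Finset.coe_insert, Finset.coe_image] at hx
      rcases hx with rfl | ⟨i, _, rfl⟩
      · exact S.mult_spec.1
      · exact S.kunz_mem i
    exact this

theorem embdim_spec (S : NumericalSemigroup) : ∃ G : Finset ℕ,
    S.carrier = (AddSubmonoid.closure (G : Set ℕ) : Set ℕ) ∧ G.card = S.embdim := by
  obtain ⟨G, hG⟩ := S.gens_exist
  exact Nat.sInf_mem (s := {n : ℕ | ∃ G : Finset ℕ,
    S.carrier = (AddSubmonoid.closure (G : Set ℕ) : Set ℕ) ∧ G.card = n}) ⟨_, G, hG, rfl⟩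

theorem irr_mult (S : NumericalSemigroup) : S.Irr S.mult := by
  refine ⟨S.mult_spec.1, S.mult_spec.2.ne', ?_⟩
  intro a ha b hb h1 h2 h
  have := S.mult_le ha (by omega)
  have := S.mult_le hb (by omega)
  omega

open Classical in
/-- Indicator of being a minimal generator. -/
noncomputable def gen (S : NumericalSemigroup) (i : ℕ) : ℕ :=
  if S.Irr (S.kunz i * S.mult + i) then 1 else 0

theorem embdim_ge (S : NumericalSemigroup) :
    1 + ∑ i ∈ Finset.Ico 1 S.mult, S.gen i ≤ S.embdim := by
  classical
  obtain ⟨G, hG, hc⟩ := S.embdim_spec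
  rw [← hc]
  have hsum : ∑ i ∈ Finset.Ico 1 S.mult, S.gen i =
      ((Finset.Ico 1 S.mult).filter (fun i => S.Irr (S.kunz i * S.mult + i))).card := by
    rw [Finset.card_filter]
    refine Finset.sum_congr rfl fun i _ => ?_
    simp [gen]
  have hinj : Set.InjOn (fun i => S.kunz i * S.mult + i)
      ((Finset.Ico 1 S.mult).filter (fun i => S.Irr (S.kunz i * S.mult + i)) : Finset ℕ) := by
    intro a ha b hb hab
    simp only [Finset.coe_filter, Finset.mem_Ico, Set.mem_ofPred_eq] at ha hb
    have : (S.kunz a * S.mult + a) % S.mult = (S.kunz b * S.mult + b) % S.mult := by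
      simp only at hab; rw [hab]
    rw [Nat.mul_add_mod_self_right, Nat.mul_add_mod_self_right,
      Nat.mod_eq_of_lt ha.1.2, Nat.mod_eq_of_lt hb.1.2] at this
    exact this
  rw [hsum, ← Finset.card_image_of_injOn hinj, add_comm, ← Finset.card_insert_of_notMem (a := S.mult)]
  · apply Finset.card_le_card
    intro x hx
    rw [Finset.mem_insert, Finset.mem_image] at hx
    rcases hx with rfl | ⟨i, hi, rfl⟩
    · exact S.irr_mem_gen _ hG S.irr_mult
    · exact S.irr_mem_gen _ hG (Finset.mem_filter.1 hi).2
  · rw [Finset.mem_image]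
    rintro ⟨i, hi, h⟩
    have hi' := Finset.mem_Ico.1 (Finset.mem_filter.1 hi).1
    have : (S.kunz i * S.mult + i) % S.mult = S.mult % S.mult := by rw [h]
    rw [Nat.mul_add_mod_self_right, Nat.mod_eq_of_lt hi'.2, Nat.mod_self] at this
    omega

theorem gen_spec (S : NumericalSemigroup) {t : ℕ} (h0 : 0 < t) (ht : t < S.mult) :
    S.gen t = 1 ∨ S.gen t = 0 ∧ ∃ i j, 0 < i ∧ i < S.mult ∧ 0 < j ∧ j < S.mult ∧
      (i + j = t ∧ S.kunz t = S.kunz i + S.kunz j ∨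
        i + j = S.mult + t ∧ S.kunz t = S.kunz i + S.kunz j + 1) := by
  by_cases hI : S.Irr (S.kunz t * S.mult + t)
  · left; simp [gen, hI]
  right
  refine ⟨by simp [gen, hI], ?_⟩
  have : ∃ a ∈ S.carrier, ∃ b ∈ S.carrier, a ≠ 0 ∧ b ≠ 0 ∧ a + b = S.kunz t * S.mult + t := by
    by_contra hcon
    push Not at hcon
    exact hI ⟨S.kunz_mem t, by omega, hcon⟩
  obtain ⟨a, ha, b, hb, ha0, hb0, hab⟩ := this
  have hm := S.mult_spec.2
  have ea : a = a / S.mult * S.mult + a % S.mult := (Nat.div_add_mod' a S.mult).symm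
  have eb : b = b / S.mult * S.mult + b % S.mult := (Nat.div_add_mod' b S.mult).symm
  have hi : a % S.mult < S.mult := Nat.mod_lt _ hm
  have hj : b % S.mult < S.mult := Nat.mod_lt _ hm
  generalize a / S.mult = p at *
  generalize a % S.mult = i at *
  generalize b / S.mult = q at *
  generalize b % S.mult = j at *
  subst ea eb
  have hp := (S.mem_iff _ _).1 ha
  have hq := (S.mem_iff _ _).1 hb
  have hkt := S.kunz_pos h0 ht
  have k0 := S.kunz_zero
  have hsum : (p + q) * S.mult + (i + j) = S.kunz t * S.mult + t := by rw [← hab]; ring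
  by_cases hlt : i + j < S.mult
  · have hm1 : ((p + q) * S.mult + (i + j)) % S.mult = (S.kunz t * S.mult + t) % S.mult := by
      rw [hsum]
    rw [Nat.mul_add_mod_self_right, Nat.mul_add_mod_self_right,
      Nat.mod_eq_of_lt hlt, Nat.mod_eq_of_lt ht] at hm1
    have hpq : p + q = S.kunz t := by
      rw [hm1] at hsum
      exact Nat.eq_of_mul_eq_mul_right hm (by omega)
    have hk := S.kunz_add i j
    rw [hm1] at hk
    refine ⟨i, j, ?_, hi, ?_, hj, Or.inl ⟨hm1, by omega⟩⟩
    · rcases Nat.eq_zero_or_pos i with rfl | h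
      · exfalso
        have hp0 : p = 0 := by
          have : j = t := by omega
          subst this
          omega
        subst hp0
        simp at ha0
      · exact h
    · rcases Nat.eq_zero_or_pos j with rfl | h
      · exfalso
        have hp0 : q = 0 := by
          have : i = t := by omega
          subst this
          omega
        subst hp0
        simp at hb0
      · exact h
  · obtain ⟨s, hs⟩ := Nat.exists_eq_add_of_le (not_lt.1 hlt)
    have hsm : s < S.mult := by omega
    have hsum' : (p + q + 1) * S.mult + s = S.kunz t * S.mult + t := by
      rw [← hsum, hs]; ring
    have hm1 : ((p + q + 1) * S.mult + s) % S.mult = (S.kunz t * S.mult + t) % S.mult := by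
      rw [hsum']
    rw [Nat.mul_add_mod_self_right, Nat.mul_add_mod_self_right,
      Nat.mod_eq_of_lt hsm, Nat.mod_eq_of_lt ht] at hm1
    subst hm1
    have hpq : p + q + 1 = S.kunz s := by
      exact Nat.eq_of_mul_eq_mul_right hm (by omega)
    have hk := S.kunz_add' i j s hs
    exact ⟨i, j, by omega, hi, by omega, hj, Or.inr ⟨hs, by omega⟩⟩

theorem frob_spec (S : NumericalSemigroup) (h : 2 ≤ S.mult) :
    ∃ f : ℕ, S.frob = f ∧ f ∉ S.carrier ∧ ∀ x, f < x → x ∈ S.carrier := by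
  have h1 : 1 ∉ S.carrier := fun h1 => by
    have := S.mult_le h1 one_pos
    omega
  have hmem1 : (1 : ℤ) ∈ {x : ℤ | ∀ s ∈ S.carrier, (s : ℤ) ≠ x} := by
    intro s hs e
    have : s = 1 := by exact_mod_cast e
    exact h1 (this ▸ hs)
  have hbdd : BddAbove {x : ℤ | ∀ s ∈ S.carrier, (s : ℤ) ≠ x} := by
    obtain ⟨B, hB⟩ := S.cofinite.bddAbove
    refine ⟨B, ?_⟩
    intro x hx
    rcases lt_or_ge x 0 with h0 | h0
    · omega
    · lift x to ℕ using h0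
      have : x ∈ (S.carrierᶜ : Set ℕ) := fun hxs => hx x hxs rfl
      exact_mod_cast hB this
  have hmem := Int.csSup_mem ⟨1, hmem1⟩ hbdd
  have hge := le_csSup hbdd hmem1
  have hpos : 0 ≤ S.frob := by unfold frob; omega
  refine ⟨S.frob.toNat, by omega, ?_, ?_⟩
  · intro hf
    exact hmem _ hf (by rw [Int.toNat_of_nonneg hpos]; rfl)
  · intro x hx
    by_contra hxs
    have : (x : ℤ) ≤ S.frob := le_csSup hbdd (by
      intro s hs e
      have : s = x := by exact_mod_cast e
      exact hxs (this ▸ hs))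
    omega

theorem small_ge (S : NumericalSemigroup) (K r : ℕ) (hf : S.frob = ((K * S.mult + r : ℕ) : ℤ)) :
    ∑ i ∈ Finset.range S.mult, ((K + if i < r then 1 else 0) - S.kunz i) ≤ S.small := by
  classical
  have hm := S.mult_spec.2
  let T : Finset (Σ _ : ℕ, ℕ) := (Finset.range S.mult).sigma
    (fun i => Finset.Ico (S.kunz i) (K + if i < r then 1 else 0))
  have hT : T.card = ∑ i ∈ Finset.range S.mult, ((K + if i < r then 1 else 0) - S.kunz i) := by
    simp [T, Finset.card_sigma]
  have hinj : Set.InjOn (fun p : (Σ _ : ℕ, ℕ) => p.2 * S.mult + p.1) (T : Set (Σ _ : ℕ, ℕ)) := by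
    rintro ⟨i, p⟩ h1 ⟨j, q⟩ h2 e
    simp only [T, Finset.mem_coe, Finset.mem_sigma, Finset.mem_range] at h1 h2
    simp only at e
    have hij : (p * S.mult + i) % S.mult = (q * S.mult + j) % S.mult := by rw [e]
    rw [Nat.mul_add_mod_self_right, Nat.mul_add_mod_self_right,
      Nat.mod_eq_of_lt h1.1, Nat.mod_eq_of_lt h2.1] at hij
    subst hij
    have : p = q := Nat.eq_of_mul_eq_mul_right hm (by omega)
    subst this
    rfl
  rw [← hT, ← Finset.card_image_of_injOn hinj, ← Set.ncard_coe_finset]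
  apply Set.ncard_le_ncard
  · intro x hx
    simp only [Finset.coe_image, Set.mem_image, Finset.mem_coe] at hx
    obtain ⟨⟨i, q⟩, hp, rfl⟩ := hx
    simp only [T, Finset.mem_sigma, Finset.mem_range, Finset.mem_Ico] at hp
    refine ⟨(S.mem_iff _ _).2 hp.2.1, ?_⟩
    rw [hf]
    norm_cast
    obtain ⟨him, _, hq⟩ := hp
    dsimp only
    split_ifs at hq with hir
    · have : q * S.mult ≤ K * S.mult := Nat.mul_le_mul_right _ (by omega)
      omega
    · have : (q + 1) * S.mult ≤ K * S.mult := Nat.mul_le_mul_right _ (by omega)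
      rw [add_mul] at this
      omega
  · refine (Set.finite_Iio (K * S.mult + r)).subset ?_
    intro x hx
    have := hx.2
    rw [hf] at this
    exact_mod_cast this

theorem interface (S : NumericalSemigroup) (h : 2 ≤ S.mult) :
    ∃ K r : ℕ, S.frob = ((K * S.mult + r : ℕ) : ℤ) ∧ 0 < r ∧ r < S.mult ∧ S.kunz r = K + 1 ∧
      ∀ i < S.mult, S.kunz i ≤ K + 1 ∧ (r < i → S.kunz i ≤ K) := by
  obtain ⟨f, hf, hfS, hfx⟩ := S.frob_spec h
  have hm := S.mult_spec.2
  have ea : f = f / S.mult * S.mult + f % S.mult := (Nat.div_add_mod' f S.mult).symm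
  have hi : f % S.mult < S.mult := Nat.mod_lt _ hm
  generalize f / S.mult = K at *
  generalize f % S.mult = r at *
  subst ea
  have hK : ¬ S.kunz r ≤ K := fun hk => hfS ((S.mem_iff _ _).2 hk)
  have hall : ∀ i < S.mult, S.kunz i ≤ K + 1 ∧ (r < i → S.kunz i ≤ K) := by
    intro i him
    constructor
    · by_cases hir : i < r ∨ i = r ∨ r < i
      · refine (S.mem_iff _ _).1 (hfx _ ?_)
        rw [add_mul]
        omega
      · omega
    · intro hri
      exact (S.mem_iff _ _).1 (hfx _ (by omega))
  refine ⟨K, r, hf, ?_, hi, ?_, hall⟩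
  · rcases Nat.eq_zero_or_pos r with rfl | hr
    · rw [S.kunz_zero] at hK; omega
    · exact hr
  · have := (hall r hi).1
    omega

theorem wilf_one (S : NumericalSemigroup) (h : S.mult = 1) : S.frob + 1 ≤ 0 := by
  have h1 := S.mult_spec.1
  rw [h] at h1
  have hall : ∀ n, n ∈ S.carrier := by
    intro n
    induction n with
    | zero => exact S.zero_mem
    | succ n ih => exact S.add_mem ih h1
  have : S.frob ≤ -1 := by
    apply csSup_le
    · exact ⟨-1, fun s _ e => by omega⟩
    · intro x hx
      by_contra hcon
      exact hx x.toNat (hall _) (by omega)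
  omega

set_option maxHeartbeats 4000000

theorem comb2 (k1 g1 K n v r : ℕ)
    (p1 : 1 ≤ k1)
    (e1 : g1 = 1 ∨ g1 = 0 ∧ (False))
    (hv : 1 + g1 ≤ v)
    (hr : (r = 1 ∧ k1 = K + 1 ∧ K + 1 ≤ n)) :
    K * 2 + r + 1 ≤ n * v := by
  refine le_trans ?_ (Nat.mul_le_mul_left n hv)
  clear hv
  rcases e1 with rfl | ⟨_, e1⟩
  · omega
  · exact e1.elim

theorem comb3 (k1 k2 g1 g2 K n v r : ℕ)
    (p1 : 1 ≤ k1)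
    (p2 : 1 ≤ k2)
    (q11 : k2 ≤ k1 + k1)
    (q22 : k1 ≤ k2 + k2 + 1)
    (e1 : g1 = 1 ∨ g1 = 0 ∧ (k1 = k2 + k2 + 1))
    (e2 : g2 = 1 ∨ g2 = 0 ∧ (k2 = k1 + k1))
    (hv : 1 + g1 + g2 ≤ v)
    (hr : (r = 1 ∧ k1 = K + 1 ∧ k2 ≤ K ∧ K + 1 + (K - k2) ≤ n) ∨
      (r = 2 ∧ k2 = K + 1 ∧ k1 ≤ K + 1 ∧ K + 1 + (K + 1 - k1) ≤ n)) :
    K * 3 + r + 1 ≤ n * v := by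
  refine le_trans ?_ (Nat.mul_le_mul_left n hv)
  clear hv
  rcases e1 with rfl | ⟨rfl, e1⟩ <;>
  rcases e2 with rfl | ⟨rfl, e2⟩ <;>
  (norm_num only; rcases hr with h | h <;> omega)

theorem comb4 (k1 k2 k3 g1 g2 g3 K n v r : ℕ)
    (p1 : 1 ≤ k1)
    (p2 : 1 ≤ k2)
    (p3 : 1 ≤ k3)
    (q11 : k2 ≤ k1 + k1)
    (q12 : k3 ≤ k1 + k2)
    (q23 : k1 ≤ k2 + k3 + 1)
    (q33 : k2 ≤ k3 + k3 + 1)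
    (e1 : g1 = 1 ∨ g1 = 0 ∧ (k1 = k2 + k3 + 1))
    (e2 : g2 = 1 ∨ g2 = 0 ∧ (k2 = k1 + k1 ∨ k2 = k3 + k3 + 1))
    (e3 : g3 = 1 ∨ g3 = 0 ∧ (k3 = k1 + k2))
    (hv : 1 + g1 + g2 + g3 ≤ v)
    (hr : (r = 1 ∧ k1 = K + 1 ∧ k2 ≤ K ∧ k3 ≤ K ∧ K + 1 + (K - k2) + (K - k3) ≤ n) ∨
      (r = 2 ∧ k2 = K + 1 ∧ k1 ≤ K + 1 ∧ k3 ≤ K ∧ K + 1 + (K + 1 - k1) + (K - k3) ≤ n) ∨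
      (r = 3 ∧ k3 = K + 1 ∧ k1 ≤ K + 1 ∧ k2 ≤ K + 1 ∧ K + 1 + (K + 1 - k1) + (K + 1 - k2) ≤ n)) :
    K * 4 + r + 1 ≤ n * v := by
  refine le_trans ?_ (Nat.mul_le_mul_left n hv)
  clear hv
  rcases e1 with rfl | ⟨rfl, e1⟩ <;>
  rcases e2 with rfl | ⟨rfl, e2⟩ <;>
  rcases e3 with rfl | ⟨rfl, e3⟩ <;>
  (norm_num only; rcases hr with h | h | h <;> omega)

theorem comb5 (k1 k2 k3 k4 g1 g2 g3 g4 K n v r : ℕ)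
    (p1 : 1 ≤ k1)
    (p2 : 1 ≤ k2)
    (p3 : 1 ≤ k3)
    (p4 : 1 ≤ k4)
    (q11 : k2 ≤ k1 + k1)
    (q12 : k3 ≤ k1 + k2)
    (q13 : k4 ≤ k1 + k3)
    (q22 : k4 ≤ k2 + k2)
    (q24 : k1 ≤ k2 + k4 + 1)
    (q33 : k1 ≤ k3 + k3 + 1)
    (q34 : k2 ≤ k3 + k4 + 1)
    (q44 : k3 ≤ k4 + k4 + 1)
    (e1 : g1 = 1 ∨ g1 = 0 ∧ (k1 = k2 + k4 + 1 ∨ k1 = k3 + k3 + 1))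
    (e2 : g2 = 1 ∨ g2 = 0 ∧ (k2 = k1 + k1 ∨ k2 = k3 + k4 + 1))
    (e3 : g3 = 1 ∨ g3 = 0 ∧ (k3 = k1 + k2 ∨ k3 = k4 + k4 + 1))
    (e4 : g4 = 1 ∨ g4 = 0 ∧ (k4 = k1 + k3 ∨ k4 = k2 + k2))
    (hv : 1 + g1 + g2 + g3 + g4 ≤ v)
    (hr : (r = 1 ∧ k1 = K + 1 ∧ k2 ≤ K ∧ k3 ≤ K ∧ k4 ≤ K ∧ K + 1 + (K - k2) + (K - k3) + (K - k4) ≤ n) ∨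
      (r = 2 ∧ k2 = K + 1 ∧ k1 ≤ K + 1 ∧ k3 ≤ K ∧ k4 ≤ K ∧ K + 1 + (K + 1 - k1) + (K - k3) + (K - k4) ≤ n) ∨
      (r = 3 ∧ k3 = K + 1 ∧ k1 ≤ K + 1 ∧ k2 ≤ K + 1 ∧ k4 ≤ K ∧ K + 1 + (K + 1 - k1) + (K + 1 - k2) + (K - k4) ≤ n) ∨
      (r = 4 ∧ k4 = K + 1 ∧ k1 ≤ K + 1 ∧ k2 ≤ K + 1 ∧ k3 ≤ K + 1 ∧ K + 1 + (K + 1 - k1) + (K + 1 - k2) + (K + 1 - k3) ≤ n)) :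
    K * 5 + r + 1 ≤ n * v := by
  refine le_trans ?_ (Nat.mul_le_mul_left n hv)
  clear hv
  rcases e1 with rfl | ⟨rfl, e1⟩ <;>
  rcases e2 with rfl | ⟨rfl, e2⟩ <;>
  rcases e3 with rfl | ⟨rfl, e3⟩ <;>
  rcases e4 with rfl | ⟨rfl, e4⟩ <;>
  (norm_num only; rcases hr with h | h | h | h <;> omega)

theorem comb6 (k1 k2 k3 k4 k5 g1 g2 g3 g4 g5 K n v r : ℕ)
    (p1 : 1 ≤ k1)
    (p2 : 1 ≤ k2)
    (p3 : 1 ≤ k3)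
    (p4 : 1 ≤ k4)
    (p5 : 1 ≤ k5)
    (q11 : k2 ≤ k1 + k1)
    (q12 : k3 ≤ k1 + k2)
    (q13 : k4 ≤ k1 + k3)
    (q14 : k5 ≤ k1 + k4)
    (q22 : k4 ≤ k2 + k2)
    (q23 : k5 ≤ k2 + k3)
    (q25 : k1 ≤ k2 + k5 + 1)
    (q34 : k1 ≤ k3 + k4 + 1)
    (q35 : k2 ≤ k3 + k5 + 1)
    (q44 : k2 ≤ k4 + k4 + 1)
    (q45 : k3 ≤ k4 + k5 + 1)
    (q55 : k4 ≤ k5 + k5 + 1)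
    (e1 : g1 = 1 ∨ g1 = 0 ∧ (k1 = k2 + k5 + 1 ∨ k1 = k3 + k4 + 1))
    (e2 : g2 = 1 ∨ g2 = 0 ∧ (k2 = k1 + k1 ∨ k2 = k3 + k5 + 1 ∨ k2 = k4 + k4 + 1))
    (e3 : g3 = 1 ∨ g3 = 0 ∧ (k3 = k1 + k2 ∨ k3 = k4 + k5 + 1))
    (e4 : g4 = 1 ∨ g4 = 0 ∧ (k4 = k1 + k3 ∨ k4 = k2 + k2 ∨ k4 = k5 + k5 + 1))
    (e5 : g5 = 1 ∨ g5 = 0 ∧ (k5 = k1 + k4 ∨ k5 = k2 + k3))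
    (hv : 1 + g1 + g2 + g3 + g4 + g5 ≤ v)
    (hr : (r = 1 ∧ k1 = K + 1 ∧ k2 ≤ K ∧ k3 ≤ K ∧ k4 ≤ K ∧ k5 ≤ K ∧ K + 1 + (K - k2) + (K - k3) + (K - k4) + (K - k5) ≤ n) ∨
      (r = 2 ∧ k2 = K + 1 ∧ k1 ≤ K + 1 ∧ k3 ≤ K ∧ k4 ≤ K ∧ k5 ≤ K ∧ K + 1 + (K + 1 - k1) + (K - k3) + (K - k4) + (K - k5) ≤ n) ∨
      (r = 3 ∧ k3 = K + 1 ∧ k1 ≤ K + 1 ∧ k2 ≤ K + 1 ∧ k4 ≤ K ∧ k5 ≤ K ∧ K + 1 + (K + 1 - k1) + (K + 1 - k2) + (K - k4) + (K - k5) ≤ n) ∨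
      (r = 4 ∧ k4 = K + 1 ∧ k1 ≤ K + 1 ∧ k2 ≤ K + 1 ∧ k3 ≤ K + 1 ∧ k5 ≤ K ∧ K + 1 + (K + 1 - k1) + (K + 1 - k2) + (K + 1 - k3) + (K - k5) ≤ n) ∨
      (r = 5 ∧ k5 = K + 1 ∧ k1 ≤ K + 1 ∧ k2 ≤ K + 1 ∧ k3 ≤ K + 1 ∧ k4 ≤ K + 1 ∧ K + 1 + (K + 1 - k1) + (K + 1 - k2) + (K + 1 - k3) + (K + 1 - k4) ≤ n)) :
    K * 6 + r + 1 ≤ n * v := by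
  refine le_trans ?_ (Nat.mul_le_mul_left n hv)
  clear hv
  rcases e1 with rfl | ⟨rfl, e1⟩ <;>
  rcases e2 with rfl | ⟨rfl, e2⟩ <;>
  rcases e3 with rfl | ⟨rfl, e3⟩ <;>
  rcases e4 with rfl | ⟨rfl, e4⟩ <;>
  rcases e5 with rfl | ⟨rfl, e5⟩ <;>
  (norm_num only; rcases hr with h | h | h | h | h <;> omega)

theorem wilf2 (S : NumericalSemigroup) (h : S.mult = 2) :
    S.frob + 1 ≤ (S.small : ℤ) * (S.embdim : ℤ) := by
  obtain ⟨K, r, hf, hr0, hrm, hkr, hall⟩ := S.interface (by omega)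
  have hn := S.small_ge K r hf
  have hv := S.embdim_ge
  have k0 := S.kunz_zero
  have hp := fun i => S.kunz_pos (i := i)
  have hq := S.kunz_add
  have hq' := S.kunz_add'
  have hg := fun t => S.gen_spec (t := t)
  rw [h] at hn hv hf hrm
  rw [hf]
  norm_cast
  simp only [h] at hp hq' hg hall
  clear hf h
  refine comb2 (S.kunz 1) (S.gen 1) K S.small S.embdim r
    (hp 1 (by omega) (by omega)) ?_
    (by simpa [Finset.sum_Ico_eq_sum_range, Finset.sum_range_succ, add_assoc] using hv) ?_
  · rcases hg 1 (by omega) (by omega) with hg | ⟨hg, i, j, hi0, hi, hj0, hj, hij⟩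
    · exact Or.inl hg
    · refine Or.inr ⟨hg, ?_⟩
      clear hg hq hq' hp hn hv hall hkr hr0 hrm k0
      interval_cases i <;> interval_cases j <;> omega
  have b1 := hall 1 (by omega)
  simp only [Finset.sum_range_succ, Finset.sum_range_zero, k0] at hn
  clear hg hq hq' hp hv hall
  interval_cases r
  · norm_num at hn
    exact ⟨rfl, by omega, by omega⟩

theorem wilf3 (S : NumericalSemigroup) (h : S.mult = 3) :
    S.frob + 1 ≤ (S.small : ℤ) * (S.embdim : ℤ) := by
  obtain ⟨K, r, hf, hr0, hrm, hkr, hall⟩ := S.interface (by omega)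
  have hn := S.small_ge K r hf
  have hv := S.embdim_ge
  have k0 := S.kunz_zero
  have hp := fun i => S.kunz_pos (i := i)
  have hq := S.kunz_add
  have hq' := S.kunz_add'
  have hg := fun t => S.gen_spec (t := t)
  rw [h] at hn hv hf hrm
  rw [hf]
  norm_cast
  simp only [h] at hp hq' hg hall
  clear hf h
  refine comb3 (S.kunz 1) (S.kunz 2) (S.gen 1) (S.gen 2) K S.small S.embdim r
    (hp 1 (by omega) (by omega))
    (hp 2 (by omega) (by omega))
    (hq 1 1)
    (hq' 2 2 1 (by omega)) ?_ ?_
    (by simpa [Finset.sum_Ico_eq_sum_range, Finset.sum_range_succ, add_assoc] using hv) ?_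
  · rcases hg 1 (by omega) (by omega) with hg | ⟨hg, i, j, hi0, hi, hj0, hj, hij⟩
    · exact Or.inl hg
    · refine Or.inr ⟨hg, ?_⟩
      clear hg hq hq' hp hn hv hall hkr hr0 hrm k0
      interval_cases i <;> interval_cases j <;> omega
  · rcases hg 2 (by omega) (by omega) with hg | ⟨hg, i, j, hi0, hi, hj0, hj, hij⟩
    · exact Or.inl hg
    · refine Or.inr ⟨hg, ?_⟩
      clear hg hq hq' hp hn hv hall hkr hr0 hrm k0
      interval_cases i <;> interval_cases j <;> omega
  have b1 := hall 1 (by omega)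
  have b2 := hall 2 (by omega)
  simp only [Finset.sum_range_succ, Finset.sum_range_zero, k0] at hn
  clear hg hq hq' hp hv hall
  interval_cases r
  · norm_num at hn
    exact Or.inl ⟨rfl, by omega, by omega, by omega⟩
  · norm_num at hn
    exact Or.inr (⟨rfl, by omega, by omega, by omega⟩)

theorem wilf4 (S : NumericalSemigroup) (h : S.mult = 4) :
    S.frob + 1 ≤ (S.small : ℤ) * (S.embdim : ℤ) := by
  obtain ⟨K, r, hf, hr0, hrm, hkr, hall⟩ := S.interface (by omega)
  have hn := S.small_ge K r hf
  have hv := S.embdim_ge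
  have k0 := S.kunz_zero
  have hp := fun i => S.kunz_pos (i := i)
  have hq := S.kunz_add
  have hq' := S.kunz_add'
  have hg := fun t => S.gen_spec (t := t)
  rw [h] at hn hv hf hrm
  rw [hf]
  norm_cast
  simp only [h] at hp hq' hg hall
  clear hf h
  refine comb4 (S.kunz 1) (S.kunz 2) (S.kunz 3) (S.gen 1) (S.gen 2) (S.gen 3) K S.small S.embdim r
    (hp 1 (by omega) (by omega))
    (hp 2 (by omega) (by omega))
    (hp 3 (by omega) (by omega))
    (hq 1 1)
    (hq 1 2)
    (hq' 2 3 1 (by omega))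
    (hq' 3 3 2 (by omega)) ?_ ?_ ?_
    (by simpa [Finset.sum_Ico_eq_sum_range, Finset.sum_range_succ, add_assoc] using hv) ?_
  · rcases hg 1 (by omega) (by omega) with hg | ⟨hg, i, j, hi0, hi, hj0, hj, hij⟩
    · exact Or.inl hg
    · refine Or.inr ⟨hg, ?_⟩
      clear hg hq hq' hp hn hv hall hkr hr0 hrm k0
      interval_cases i <;> interval_cases j <;> omega
  · rcases hg 2 (by omega) (by omega) with hg | ⟨hg, i, j, hi0, hi, hj0, hj, hij⟩
    · exact Or.inl hg
    · refine Or.inr ⟨hg, ?_⟩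
      clear hg hq hq' hp hn hv hall hkr hr0 hrm k0
      interval_cases i <;> interval_cases j <;> omega
  · rcases hg 3 (by omega) (by omega) with hg | ⟨hg, i, j, hi0, hi, hj0, hj, hij⟩
    · exact Or.inl hg
    · refine Or.inr ⟨hg, ?_⟩
      clear hg hq hq' hp hn hv hall hkr hr0 hrm k0
      interval_cases i <;> interval_cases j <;> omega
  have b1 := hall 1 (by omega)
  have b2 := hall 2 (by omega)
  have b3 := hall 3 (by omega)
  simp only [Finset.sum_range_succ, Finset.sum_range_zero, k0] at hn
  clear hg hq hq' hp hv hall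
  interval_cases r
  · norm_num at hn
    exact Or.inl ⟨rfl, by omega, by omega, by omega, by omega⟩
  · norm_num at hn
    exact Or.inr (Or.inl ⟨rfl, by omega, by omega, by omega, by omega⟩)
  · norm_num at hn
    exact Or.inr (Or.inr (⟨rfl, by omega, by omega, by omega, by omega⟩))

theorem wilf5 (S : NumericalSemigroup) (h : S.mult = 5) :
    S.frob + 1 ≤ (S.small : ℤ) * (S.embdim : ℤ) := by
  obtain ⟨K, r, hf, hr0, hrm, hkr, hall⟩ := S.interface (by omega)
  have hn := S.small_ge K r hf
  have hv := S.embdim_ge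
  have k0 := S.kunz_zero
  have hp := fun i => S.kunz_pos (i := i)
  have hq := S.kunz_add
  have hq' := S.kunz_add'
  have hg := fun t => S.gen_spec (t := t)
  rw [h] at hn hv hf hrm
  rw [hf]
  norm_cast
  simp only [h] at hp hq' hg hall
  clear hf h
  refine comb5 (S.kunz 1) (S.kunz 2) (S.kunz 3) (S.kunz 4) (S.gen 1) (S.gen 2) (S.gen 3) (S.gen 4) K S.small S.embdim r
    (hp 1 (by omega) (by omega))
    (hp 2 (by omega) (by omega))
    (hp 3 (by omega) (by omega))
    (hp 4 (by omega) (by omega))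
    (hq 1 1)
    (hq 1 2)
    (hq 1 3)
    (hq 2 2)
    (hq' 2 4 1 (by omega))
    (hq' 3 3 1 (by omega))
    (hq' 3 4 2 (by omega))
    (hq' 4 4 3 (by omega)) ?_ ?_ ?_ ?_
    (by simpa [Finset.sum_Ico_eq_sum_range, Finset.sum_range_succ, add_assoc] using hv) ?_
  · rcases hg 1 (by omega) (by omega) with hg | ⟨hg, i, j, hi0, hi, hj0, hj, hij⟩
    · exact Or.inl hg
    · refine Or.inr ⟨hg, ?_⟩
      clear hg hq hq' hp hn hv hall hkr hr0 hrm k0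
      interval_cases i <;> interval_cases j <;> omega
  · rcases hg 2 (by omega) (by omega) with hg | ⟨hg, i, j, hi0, hi, hj0, hj, hij⟩
    · exact Or.inl hg
    · refine Or.inr ⟨hg, ?_⟩
      clear hg hq hq' hp hn hv hall hkr hr0 hrm k0
      interval_cases i <;> interval_cases j <;> omega
  · rcases hg 3 (by omega) (by omega) with hg | ⟨hg, i, j, hi0, hi, hj0, hj, hij⟩
    · exact Or.inl hg
    · refine Or.inr ⟨hg, ?_⟩
      clear hg hq hq' hp hn hv hall hkr hr0 hrm k0
      interval_cases i <;> interval_cases j <;> omega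
  · rcases hg 4 (by omega) (by omega) with hg | ⟨hg, i, j, hi0, hi, hj0, hj, hij⟩
    · exact Or.inl hg
    · refine Or.inr ⟨hg, ?_⟩
      clear hg hq hq' hp hn hv hall hkr hr0 hrm k0
      interval_cases i <;> interval_cases j <;> omega
  have b1 := hall 1 (by omega)
  have b2 := hall 2 (by omega)
  have b3 := hall 3 (by omega)
  have b4 := hall 4 (by omega)
  simp only [Finset.sum_range_succ, Finset.sum_range_zero, k0] at hn
  clear hg hq hq' hp hv hall
  interval_cases r
  · norm_num at hn
    exact Or.inl ⟨rfl, by omega, by omega, by omega, by omega, by omega⟩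
  · norm_num at hn
    exact Or.inr (Or.inl ⟨rfl, by omega, by omega, by omega, by omega, by omega⟩)
  · norm_num at hn
    exact Or.inr (Or.inr (Or.inl ⟨rfl, by omega, by omega, by omega, by omega, by omega⟩))
  · norm_num at hn
    exact Or.inr (Or.inr (Or.inr (⟨rfl, by omega, by omega, by omega, by omega, by omega⟩)))

theorem wilf6 (S : NumericalSemigroup) (h : S.mult = 6) :
    S.frob + 1 ≤ (S.small : ℤ) * (S.embdim : ℤ) := by
  obtain ⟨K, r, hf, hr0, hrm, hkr, hall⟩ := S.interface (by omega)
  have hn := S.small_ge K r hf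
  have hv := S.embdim_ge
  have k0 := S.kunz_zero
  have hp := fun i => S.kunz_pos (i := i)
  have hq := S.kunz_add
  have hq' := S.kunz_add'
  have hg := fun t => S.gen_spec (t := t)
  rw [h] at hn hv hf hrm
  rw [hf]
  norm_cast
  simp only [h] at hp hq' hg hall
  clear hf h
  refine comb6 (S.kunz 1) (S.kunz 2) (S.kunz 3) (S.kunz 4) (S.kunz 5) (S.gen 1) (S.gen 2) (S.gen 3) (S.gen 4) (S.gen 5) K S.small S.embdim r
    (hp 1 (by omega) (by omega))
    (hp 2 (by omega) (by omega))
    (hp 3 (by omega) (by omega))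
    (hp 4 (by omega) (by omega))
    (hp 5 (by omega) (by omega))
    (hq 1 1)
    (hq 1 2)
    (hq 1 3)
    (hq 1 4)
    (hq 2 2)
    (hq 2 3)
    (hq' 2 5 1 (by omega))
    (hq' 3 4 1 (by omega))
    (hq' 3 5 2 (by omega))
    (hq' 4 4 2 (by omega))
    (hq' 4 5 3 (by omega))
    (hq' 5 5 4 (by omega)) ?_ ?_ ?_ ?_ ?_
    (by simpa [Finset.sum_Ico_eq_sum_range, Finset.sum_range_succ, add_assoc] using hv) ?_
  · rcases hg 1 (by omega) (by omega) with hg | ⟨hg, i, j, hi0, hi, hj0, hj, hij⟩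
    · exact Or.inl hg
    · refine Or.inr ⟨hg, ?_⟩
      clear hg hq hq' hp hn hv hall hkr hr0 hrm k0
      interval_cases i <;> interval_cases j <;> omega
  · rcases hg 2 (by omega) (by omega) with hg | ⟨hg, i, j, hi0, hi, hj0, hj, hij⟩
    · exact Or.inl hg
    · refine Or.inr ⟨hg, ?_⟩
      clear hg hq hq' hp hn hv hall hkr hr0 hrm k0
      interval_cases i <;> interval_cases j <;> omega
  · rcases hg 3 (by omega) (by omega) with hg | ⟨hg, i, j, hi0, hi, hj0, hj, hij⟩
    · exact Or.inl hg
    · refine Or.inr ⟨hg, ?_⟩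
      clear hg hq hq' hp hn hv hall hkr hr0 hrm k0
      interval_cases i <;> interval_cases j <;> omega
  · rcases hg 4 (by omega) (by omega) with hg | ⟨hg, i, j, hi0, hi, hj0, hj, hij⟩
    · exact Or.inl hg
    · refine Or.inr ⟨hg, ?_⟩
      clear hg hq hq' hp hn hv hall hkr hr0 hrm k0
      interval_cases i <;> interval_cases j <;> omega
  · rcases hg 5 (by omega) (by omega) with hg | ⟨hg, i, j, hi0, hi, hj0, hj, hij⟩
    · exact Or.inl hg
    · refine Or.inr ⟨hg, ?_⟩
      clear hg hq hq' hp hn hv hall hkr hr0 hrm k0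
      interval_cases i <;> interval_cases j <;> omega
  have b1 := hall 1 (by omega)
  have b2 := hall 2 (by omega)
  have b3 := hall 3 (by omega)
  have b4 := hall 4 (by omega)
  have b5 := hall 5 (by omega)
  simp only [Finset.sum_range_succ, Finset.sum_range_zero, k0] at hn
  clear hg hq hq' hp hv hall
  interval_cases r
  · norm_num at hn
    exact Or.inl ⟨rfl, by omega, by omega, by omega, by omega, by omega, by omega⟩
  · norm_num at hn
    exact Or.inr (Or.inl ⟨rfl, by omega, by omega, by omega, by omega, by omega, by omega⟩)
  · norm_num at hn
    exact Or.inr (Or.inr (Or.inl ⟨rfl, by omega, by omega, by omega, by omega, by omega, by omega⟩))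
  · norm_num at hn
    exact Or.inr (Or.inr (Or.inr (Or.inl ⟨rfl, by omega, by omega, by omega, by omega, by omega, by omega⟩)))
  · norm_num at hn
    exact Or.inr (Or.inr (Or.inr (Or.inr (⟨rfl, by omega, by omega, by omega, by omega, by omega, by omega⟩))))

/-- If `m(S) ≤ 6` then `S` satisfies Wilf's conjecture. -/
theorem wilf_of_mult_le_six (S : NumericalSemigroup)
    (h : S.mult ≤ 6) :
    S.frob + 1 ≤ (S.small : ℤ) * (S.embdim : ℤ) := by
  have hm := S.mult_spec.2
  have hc : S.mult = 1 ∨ S.mult = 2 ∨ S.mult = 3 ∨ S.mult = 4 ∨ S.mult = 5 ∨ S.mult = 6 := by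
    omega
  rcases hc with h | h | h | h | h | h
  · exact (S.wilf_one h).trans (by positivity)
  · exact S.wilf2 h
  · exact S.wilf3 h
  · exact S.wilf4 h
  · exact S.wilf5 h
  · exact S.wilf6 h

end NumericalSemigroup
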